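/- arXiv:2407.12984 — 3 statements merged into one kernel-verified Lean document; each statement's English description precedes it below -/
import Mathlib

section
/- There exists a universal constant C > 0 such that for any x⋆ ∈ ℝ^d with ‖x⋆‖ ≥ 1 and any m ≥ C·d·‖x⋆‖², the loss at the origin satisfies P( f(0) ≤ 1/5 ) ≤ exp(−d/2). -/
open MeasureTheory ProbabilityTheory Real
open scoped RealInnerProductSpace ENNReal BigOperators Classical

noncomputable section

/-- Standard Gaussian measure `N(0, I_d)` on `ℝ^d`. -/
def stdGaussian (d : ℕ) : Measure (EuclideanSpace ℝ (Fin d)) :=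
  (Measure.pi fun _ : Fin d => gaussianReal 0 1).map (EuclideanSpace.equiv (Fin d) ℝ).symm

/-- The joint distribution of `m` i.i.d. standard Gaussian vectors in `ℝ^d`. -/
def iidGaussian (d m : ℕ) : Measure (Fin m → EuclideanSpace ℝ (Fin d)) :=
  Measure.pi fun _ : Fin m => stdGaussian d

/-- The loss `f(x) = (1/m) ∑ᵢ |yᵢ - hᵢ(x)|` where `yᵢ = 1 - exp(-⟨aᵢ,x⋆⟩₊)` and
`hᵢ(x) = 1 - exp(-⟨aᵢ,x⟩₊)`. -/
def loss {d m : ℕ} (xstar : EuclideanSpace ℝ (Fin d))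
    (a : Fin m → EuclideanSpace ℝ (Fin d)) (x : EuclideanSpace ℝ (Fin d)) : ℝ :=
  (1 / m) * ∑ i, |(1 - Real.exp (-max ⟪a i, xstar⟫ 0)) - (1 - Real.exp (-max ⟪a i, x⟫ 0))|

/-- The complementary error function `erfc(t) = (2/√π) ∫_t^∞ exp(-u²) du`. -/
def erfc (t : ℝ) : ℝ := 2 / Real.sqrt π * ∫ u in Set.Ioi t, Real.exp (-u ^ 2)

/-- Taylor bound. -/
lemma aux_exp_bound (z : ℝ) (hz : 0 ≤ z) :
    z - z ^ 2 / 2 + z ^ 3 / 6 - z ^ 4 / 24 ≤ 1 - Real.exp (-z) := by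
  have h := Real.sum_le_exp_of_nonneg hz 5
  simp [Finset.sum_range_succ, Nat.factorial] at h
  have h2 : Real.exp z * Real.exp (-z) = 1 := by rw [← Real.exp_add]; simp
  have h3 : 1 ≤ (1 + z + z ^ 2 / 2 + z ^ 3 / 6 + z ^ 4 / 24) *
      (1 - z + z ^ 2 / 2 - z ^ 3 / 6 + z ^ 4 / 24) := by
    have : 0 ≤ z ^ 6 * (1/72) + z ^ 8 / 576 := by positivity
    linarith
  have h4 : 0 < 1 + z + z ^ 2 / 2 + z ^ 3 / 6 + z ^ 4 / 24 := by positivity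
  have h5 : (1 + z + z ^ 2 / 2 + z ^ 3 / 6 + z ^ 4 / 24) * Real.exp (-z) ≤ 1 := by
    calc _ ≤ Real.exp z * Real.exp (-z) := by gcongr
      _ = 1 := h2
  have h6 := le_of_mul_le_mul_left (h5.trans h3) h4
  linarith

lemma aux_int (n : ℕ) :
    IntegrableOn (fun x : ℝ => x ^ n * Real.exp (-(1/2) * x ^ 2)) (Set.Ioi 0) := by
  have := integrableOn_rpow_mul_exp_neg_mul_sq (b := 1/2) (by norm_num) (s := n)
    (by have : (0:ℝ) ≤ n := by positivity
        linarith)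
  simpa [Real.rpow_natCast] using this

lemma aux_moment (n : ℕ) :
    ∫ x in Set.Ioi (0 : ℝ), x ^ n * Real.exp (-(1/2) * x ^ 2) =
      (1/2 : ℝ) ^ (-((n:ℝ) + 1) / 2) * (1 / 2) * Real.Gamma (((n:ℝ) + 1) / 2) := by
  have := integral_rpow_mul_exp_neg_mul_rpow (p := 2) (q := n) (b := 1/2) (by norm_num)
    (by have : (0:ℝ) ≤ n := by positivity
        linarith) (by norm_num)
  rw [← this]
  simp [Real.rpow_natCast]

lemma aux_m1 : ∫ x in Set.Ioi (0 : ℝ), x ^ 1 * Real.exp (-(1/2) * x ^ 2) = 1 := by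
  rw [aux_moment]
  norm_num

lemma aux_m3 : ∫ x in Set.Ioi (0 : ℝ), x ^ 3 * Real.exp (-(1/2) * x ^ 2) = 2 := by
  rw [aux_moment]
  rw [show -(((3:ℕ):ℝ) + 1) / 2 = ((-2 : ℤ) : ℝ) by norm_num, Real.rpow_intCast,
    show (((3:ℕ):ℝ) + 1) / 2 = ((1:ℕ) : ℝ) + 1 by norm_num, Real.Gamma_nat_eq_factorial]
  norm_num [zpow_neg]

lemma aux_half : (1/2:ℝ) ^ (-(1/2) : ℝ) = √2 := by
  rw [Real.rpow_neg (by norm_num), ← Real.sqrt_eq_rpow, ← Real.sqrt_inv]; norm_num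

lemma aux_m2 : ∫ x in Set.Ioi (0 : ℝ), x ^ 2 * Real.exp (-(1/2) * x ^ 2) = √2 * √π / 2 := by
  rw [aux_moment]
  rw [show -(((2:ℕ):ℝ) + 1) / 2 = (-(1/2) : ℝ) + ((-1 : ℤ) : ℝ) by norm_num,
    Real.rpow_add (by norm_num), Real.rpow_intCast, aux_half,
    show (((2:ℕ):ℝ) + 1) / 2 = 1/2 + 1 by norm_num, Real.Gamma_add_one (by norm_num),
    Real.Gamma_one_half_eq]
  norm_num [zpow_neg]; ring

lemma aux_m4 : ∫ x in Set.Ioi (0 : ℝ), x ^ 4 * Real.exp (-(1/2) * x ^ 2)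
    = 3 * (√2 * √π) / 2 := by
  rw [aux_moment]
  rw [show -(((4:ℕ):ℝ) + 1) / 2 = (-(1/2) : ℝ) + ((-2 : ℤ) : ℝ) by norm_num,
    Real.rpow_add (by norm_num), Real.rpow_intCast, aux_half,
    show (((4:ℕ):ℝ) + 1) / 2 = (1/2 + 1) + 1 by norm_num, Real.Gamma_add_one (by norm_num),
    Real.Gamma_add_one (by norm_num), Real.Gamma_one_half_eq]
  norm_num [zpow_neg]; ring

lemma aux_g_mem (t : ℝ) : 1 - Real.exp (-max t 0) ∈ Set.Icc (0:ℝ) 1 := by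
  constructor
  · have : Real.exp (-max t 0) ≤ 1 := Real.exp_le_one_iff.2 (by simp)
    linarith
  · have := Real.exp_pos (-max t 0)
    linarith

lemma aux_meas : Measurable (fun t : ℝ => 1 - Real.exp (-max t 0)) := by fun_prop

lemma aux_gauss :
    (21/100 : ℝ) ≤ ∫ z, (1 - Real.exp (-max z 0)) ∂(gaussianReal 0 1) := by
  set c : ℝ := √2 * √π with hc
  have hcpos : 0 < c := by positivity
  have hc2 : c ≤ 2.54 := by
    rw [hc, ← Real.sqrt_mul (by norm_num)]
    apply Real.sqrt_le_iff.2 ⟨by norm_num, ?_⟩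
    have := Real.pi_lt_d2
    norm_num; linarith
  rw [integral_gaussianReal_eq_integral_smul (by norm_num)]
  have hpdf : ∀ z, gaussianPDFReal 0 1 z = c⁻¹ * Real.exp (-(1/2) * z ^ 2) := by
    intro z
    simp only [gaussianPDFReal, hc]
    rw [← Real.sqrt_mul (by norm_num)]
    congr 2
    · simp
    · simp; ring
  have hint : Integrable (fun z => gaussianPDFReal 0 1 z • (1 - Real.exp (-max z 0))) := by
    refine (integrable_gaussianPDFReal 0 1).mono' ?_ ?_
    · exact ((measurable_gaussianPDFReal 0 1).mul aux_meas).aestronglyMeasurable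
    · refine .of_forall fun z => ?_
      have h1 := aux_g_mem z
      have h2 := gaussianPDFReal_nonneg 0 1 z
      rw [norm_smul, Real.norm_of_nonneg h2, Real.norm_of_nonneg h1.1]
      exact mul_le_of_le_one_right h2 h1.2
  have hset : ∫ z in Set.Ioi (0:ℝ), gaussianPDFReal 0 1 z • (1 - Real.exp (-max z 0)) ≤
      ∫ z, gaussianPDFReal 0 1 z • (1 - Real.exp (-max z 0)) := by
    refine setIntegral_le_integral hint (.of_forall fun z => ?_)
    exact mul_nonneg (gaussianPDFReal_nonneg 0 1 z) (aux_g_mem z).1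
  refine le_trans ?_ hset
  have i1 := aux_int 1
  have i2 := (aux_int 2).mul_const (1/2)
  have i3 := (aux_int 3).mul_const (1/6)
  have i4 := (aux_int 4).mul_const (1/24)
  have hI : ∫ z in Set.Ioi (0:ℝ), c⁻¹ * (z ^ 1 * Real.exp (-(1/2) * z ^ 2)
      - z ^ 2 * Real.exp (-(1/2) * z ^ 2) * (1/2) + z ^ 3 * Real.exp (-(1/2) * z ^ 2) * (1/6)
      - z ^ 4 * Real.exp (-(1/2) * z ^ 2) * (1/24)) = c⁻¹ * (4/3 - c * (5/16)) := by
    rw [integral_const_mul, integral_sub (by exact (i1.sub i2).add i3) i4,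
      integral_add (by exact i1.sub i2) i3,
      integral_sub i1 i2, integral_mul_const, integral_mul_const, integral_mul_const,
      aux_m1, aux_m2, aux_m3, aux_m4]
    ring
  have hle : c⁻¹ * (4/3 - c * (5/16)) ≤
      ∫ z in Set.Ioi (0:ℝ), gaussianPDFReal 0 1 z • (1 - Real.exp (-max z 0)) := by
    rw [← hI]
    refine setIntegral_mono_on ((((i1.sub i2).add i3).sub i4).const_mul _) hint.integrableOn
      measurableSet_Ioi fun z hz => ?_
    have hz' : (0:ℝ) ≤ z := le_of_lt hz
    rw [hpdf, max_eq_left hz', smul_eq_mul]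
    have h1 := mul_le_mul_of_nonneg_left (aux_exp_bound z hz')
      (show 0 ≤ c⁻¹ * Real.exp (-(1/2) * z ^ 2) by positivity)
    linarith
  refine le_trans ?_ hle
  rw [mul_sub, ← mul_assoc, inv_mul_cancel₀ hcpos.ne']
  have : (2.54:ℝ)⁻¹ ≤ c⁻¹ := inv_anti₀ hcpos hc2
  norm_num at this ⊢
  linarith

lemma aux_std (d : ℕ) : _root_.stdGaussian d =
    ProbabilityTheory.stdGaussian (EuclideanSpace ℝ (Fin d)) := by
  rw [← map_pi_eq_stdGaussian]
  rfl

instance aux_prob (d : ℕ) : IsProbabilityMeasure (_root_.stdGaussian d) := by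
  rw [aux_std]; infer_instance

lemma aux_inner_meas {d : ℕ} (x : EuclideanSpace ℝ (Fin d)) :
    Measurable (fun a : EuclideanSpace ℝ (Fin d) => 1 - Real.exp (-max ⟪a, x⟫ 0)) := by
  fun_prop

lemma aux_mean {d : ℕ} (x : EuclideanSpace ℝ (Fin d)) (hx : 1 ≤ ‖x‖) :
    (21/100 : ℝ) ≤ ∫ a, (1 - Real.exp (-max ⟪a, x⟫ 0)) ∂(_root_.stdGaussian d) := by
  have hmap : (_root_.stdGaussian d).map (fun a => ⟪a, x⟫) =
      (gaussianReal 0 1).map (fun z => ‖x‖ * z) := by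
    rw [aux_std]
    have h := IsGaussian.map_eq_gaussianReal
      (μ := ProbabilityTheory.stdGaussian (EuclideanSpace ℝ (Fin d))) (innerSL ℝ x)
    rw [integral_strongDual_stdGaussian, variance_dual_stdGaussian, innerSL_apply_norm] at h
    rw [gaussianReal_map_const_mul]
    have e : (fun a => ⟪a, x⟫) = (innerSL ℝ x : EuclideanSpace ℝ (Fin d) → ℝ) := by
      ext a; simp [real_inner_comm]
    rw [e, h]
    congr 1
    · simp
    · ext; simp
  have h1 : ∫ a, (1 - Real.exp (-max ⟪a, x⟫ 0)) ∂(_root_.stdGaussian d) =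
      ∫ z, (1 - Real.exp (-max (‖x‖ * z) 0)) ∂(gaussianReal 0 1) := by
    rw [← integral_map (φ := fun a => ⟪a, x⟫) (f := fun t : ℝ => 1 - Real.exp (-max t 0))
      (by fun_prop) aux_meas.aestronglyMeasurable, hmap,
      integral_map (by fun_prop) aux_meas.aestronglyMeasurable]
  rw [h1]
  refine aux_gauss.trans (integral_mono ?_ ?_ fun z => ?_)
  · exact Integrable.of_mem_Icc 0 1 aux_meas.aemeasurable (.of_forall fun z => aux_g_mem z)
  · exact Integrable.of_mem_Icc 0 1 (aux_meas.comp (measurable_const_mul ‖x‖)).aemeasurable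
      (.of_forall fun z => aux_g_mem _)
  · have : max z 0 ≤ max (‖x‖ * z) 0 := by
      rcases le_total z 0 with h | h
      · rw [max_eq_right h]; exact le_max_right _ _
      · rw [max_eq_left h]; exact le_max_of_le_left (le_mul_of_one_le_left h hx)
    simp only
    gcongr

/-- There is a universal constant `C > 0` so that if `‖x⋆‖ ≥ 1` and `m ≥ C d ‖x⋆‖²`,
then `P(f(0) ≤ 1/5) ≤ exp(-d/2)`. -/
theorem loss_at_origin_lower_bound :
    ∃ C : ℝ, 0 < C ∧
      ∀ (d m : ℕ) (xstar : EuclideanSpace ℝ (Fin d)), 1 ≤ d → 1 ≤ m →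
        1 ≤ ‖xstar‖ → C * d * ‖xstar‖ ^ 2 ≤ m →
        iidGaussian d m {a | loss xstar a 0 ≤ 1 / 5}
          ≤ ENNReal.ofReal (Real.exp (-(d : ℝ) / 2)) := by
  refine ⟨2500, by norm_num, fun d m x hd hm hx hC => ?_⟩
  set e : ℝ := ∫ a, (1 - Real.exp (-max ⟪a, x⟫ 0)) ∂(_root_.stdGaussian d) with he
  have hmean : (21/100 : ℝ) ≤ e := aux_mean x hx
  have : IsProbabilityMeasure (iidGaussian d m) := by unfold iidGaussian; infer_instance
  let Y : EuclideanSpace ℝ (Fin d) → ℝ := fun a => -(1 - Real.exp (-max ⟪a, x⟫ 0))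
  have hY : Measurable Y := (aux_inner_meas x).neg
  have hYi : ∀ i : Fin m, ∫ a, Y (a i) ∂(iidGaussian d m) = -e := by
    intro i
    have := (measurePreserving_eval (fun _ : Fin m => _root_.stdGaussian d) i)
    rw [he, ← integral_neg, ← this.map_eq, integral_map this.measurable.aemeasurable hY.aestronglyMeasurable]
    rfl
  have hind : iIndepFun (fun (i : Fin m) (a : Fin m → EuclideanSpace ℝ (Fin d)) =>
      Y (a i) - (-e)) (iidGaussian d m) :=
    iIndepFun_pi (X := fun _ a => Y a - (-e)) (fun i => (hY.sub_const _).aemeasurable)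
  have hsub : ∀ i ∈ (Finset.univ : Finset (Fin m)), HasSubgaussianMGF
      (fun a : Fin m → EuclideanSpace ℝ (Fin d) => Y (a i) - (-e))
      ((‖(0:ℝ) - (-1)‖₊ / 2) ^ 2) (iidGaussian d m) := by
    intro i _
    have := hasSubgaussianMGF_of_mem_Icc (μ := iidGaussian d m) (a := -1) (b := 0)
      (X := fun a => Y (a i)) (hY.comp (measurable_pi_apply i)).aemeasurable
      (.of_forall fun a => by
        have := aux_g_mem ⟪a i, x⟫
        constructor <;> simp only [Y] <;> linarith [this.1, this.2])
    rwa [hYi] at this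
  have hm0 : (0:ℝ) < m := by exact_mod_cast hm
  have H := HasSubgaussianMGF.measure_sum_ge_le_of_iIndepFun hind hsub
    (ε := m * (1/100)) (by positivity)
  have hincl : {a : Fin m → EuclideanSpace ℝ (Fin d) | loss x a 0 ≤ 1 / 5} ⊆
      {a | (m:ℝ) * (1/100) ≤ ∑ i, (Y (a i) - (-e))} := by
    intro a ha
    simp only [Set.mem_ofPred_eq, loss] at ha ⊢
    have e1 : ∀ i, |(1 - Real.exp (-max ⟪a i, x⟫ 0)) -
        (1 - Real.exp (-max ⟪a i, (0 : EuclideanSpace ℝ (Fin d))⟫ 0))| = - Y (a i) := by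
      intro i
      simp only [inner_zero_right, max_self, neg_zero, Real.exp_zero, sub_self, sub_zero, Y,
        neg_neg]
      exact abs_of_nonneg (aux_g_mem _).1
    simp only [e1, Finset.sum_neg_distrib] at ha
    rw [Finset.sum_sub_distrib]
    simp only [Finset.sum_const, Finset.card_univ, Fintype.card_fin, nsmul_eq_mul]
    rw [one_div, inv_mul_le_iff₀ hm0] at ha
    nlinarith
  rw [← ofReal_measureReal]
  refine ENNReal.ofReal_le_ofReal ((measureReal_mono hincl).trans (H.trans ?_))
  rw [Real.exp_le_exp]
  have hsum : ((∑ i : Fin m, ((‖(0:ℝ) - (-1)‖₊ / 2) ^ 2 : NNReal) : NNReal) : ℝ) = m / 4 := by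
    simp
    ring
  push_cast at hsum ⊢
  rw [hsum]
  have hd0 : (0:ℝ) ≤ d := by positivity
  have hCd : 2500 * (d:ℝ) ≤ m := by
    refine le_trans (le_mul_of_one_le_right (by positivity) (one_le_pow₀ hx)) hC
  have : -((m:ℝ) * (1/100)) ^ 2 / (2 * (m / 4)) = - (m / 5000) := by
    field_simp; norm_num
  rw [this]
  linarith
end
end

section
/- For arbitrary (deterministic) vectors a₁, …, a_m, x⋆, x ∈ ℝ^d, the explicit subgradient selection g satisfies the identity ⟨g(x), x − x⋆⟩ = (1/m) Σ_{i=1}^m exp(−⟨aᵢ, x⟩)·|⟨aᵢ, x − x⋆⟩|·𝟙{⟨aᵢ, x⟩ > 0} + (1/m) Σ_{i=1}^m 𝟙{⟨aᵢ, x⟩ = 0}·⟨aᵢ, x⋆⟩₊. -/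
open Real
open scoped RealInnerProductSpace BigOperators Classical

noncomputable section

/-- `sgn₀(t) = 1` for `t > 0`, `-1` for `t < 0`, and `0` at `t = 0`. -/
def sgn0 (t : ℝ) : ℝ := if 0 < t then 1 else if t < 0 then -1 else 0

/-- `𝟙₊(t) = 1` for `t ≥ 0` and `0` for `t < 0`. -/
def indNonneg (t : ℝ) : ℝ := if 0 ≤ t then 1 else 0

/-- The explicit subgradient selection
`g(x) = -(1/m) ∑ᵢ sgn₀(yᵢ - hᵢ(x)) exp(-⟨aᵢ,x⟩₊) 𝟙₊(⟨aᵢ,x⟩) aᵢ`. -/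
def subgrad {d m : ℕ} (xstar : EuclideanSpace ℝ (Fin d))
    (a : Fin m → EuclideanSpace ℝ (Fin d)) (x : EuclideanSpace ℝ (Fin d)) :
    EuclideanSpace ℝ (Fin d) :=
  -((1 / m : ℝ) • ∑ i,
      (sgn0 ((1 - Real.exp (-max ⟪a i, xstar⟫ 0)) - (1 - Real.exp (-max ⟪a i, x⟫ 0))) *
        Real.exp (-max ⟪a i, x⟫ 0) * indNonneg ⟪a i, x⟫) • a i)

theorem subgrad_scalar (s t : ℝ) :
    -((sgn0 ((1 - Real.exp (-max t 0)) - (1 - Real.exp (-max s 0))) *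
        Real.exp (-max s 0) * indNonneg s) * (s - t)) =
      Real.exp (-s) * |s - t| * (if 0 < s then (1 : ℝ) else 0)
        + (if s = 0 then (1 : ℝ) else 0) * max t 0 := by
  have h : sgn0 ((1 - Real.exp (-max t 0)) - (1 - Real.exp (-max s 0)))
      = sgn0 (max t 0 - max s 0) := by
    rcases lt_trichotomy (max t 0) (max s 0) with h | h | h
    · have h1 : Real.exp (-max s 0) < Real.exp (-max t 0) := Real.exp_lt_exp.2 (by linarith)
      unfold sgn0
      rw [if_neg (by linarith), if_pos (by linarith), if_neg (by linarith), if_pos (by linarith)]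
    · simp [h]
    · have h1 : Real.exp (-max t 0) < Real.exp (-max s 0) := Real.exp_lt_exp.2 (by linarith)
      unfold sgn0
      rw [if_pos (by linarith), if_pos (by linarith)]
  rw [h]
  unfold sgn0 indNonneg
  rcases lt_trichotomy s 0 with hs | hs | hs
  · simp [not_le.2 hs, not_lt.2 hs.le, hs.ne]
  · subst hs
    rcases le_or_gt t 0 with ht | ht
    · simp [max_eq_right ht]
    · simp [max_eq_left ht.le, ht]
  · rw [max_eq_left hs.le, if_pos hs.le, if_pos hs, if_neg hs.ne']
    rcases lt_trichotomy t s with h | h | h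
    · have h2 : max t 0 < s := max_lt h hs
      rw [if_neg (by linarith), if_pos (by linarith), abs_of_pos (by linarith)]
      ring
    · subst h
      simp
    · rw [max_eq_left (by linarith), if_pos (by linarith), abs_of_neg (by linarith)]
      ring

/-- Subdifferential inner product identity:
`⟨g(x), x - x⋆⟩ = (1/m) ∑ᵢ exp(-⟨aᵢ,x⟩)|⟨aᵢ,x-x⋆⟩| 𝟙{⟨aᵢ,x⟩>0}
  + (1/m) ∑ᵢ 𝟙{⟨aᵢ,x⟩=0} ⟨aᵢ,x⋆⟩₊`. -/
theorem subgrad_inner_product (d m : ℕ) (a : Fin m → EuclideanSpace ℝ (Fin d))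
    (xstar x : EuclideanSpace ℝ (Fin d)) :
    ⟪subgrad xstar a x, x - xstar⟫ =
      (1 / m) * ∑ i, Real.exp (-⟪a i, x⟫) * |⟪a i, x - xstar⟫| *
          (if 0 < ⟪a i, x⟫ then (1 : ℝ) else 0)
        + (1 / m) * ∑ i, (if ⟪a i, x⟫ = 0 then (1 : ℝ) else 0) * max ⟪a i, xstar⟫ 0 := by
  rw [← mul_add, ← Finset.sum_add_distrib]
  unfold subgrad
  rw [inner_neg_left, real_inner_smul_left, sum_inner, ← mul_neg, ← Finset.sum_neg_distrib]
  congr 1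
  refine Finset.sum_congr rfl fun i _ => ?_
  rw [real_inner_smul_left, inner_sub_right]
  exact subgrad_scalar _ _
end
end

section
/- Let a ∈ ℝ^d be a single standard Gaussian vector a ~ N(0, I_d), and let x⋆ ∈ ℝ^d with ‖x⋆‖ ≥ 1. Then for every x ∈ ℝ^d with 0 < ‖x‖ ≤ 3‖x⋆‖, E[ exp(−⟨a, x⟩)·|⟨a, x − x⋆⟩|·𝟙{⟨a, x⟩ > 0} ] ≥ ‖x − x⋆‖ / (√(8π)·(1 + 9π·‖x⋆‖²)). -/
open MeasureTheory ProbabilityTheory Real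
open scoped RealInnerProductSpace ENNReal BigOperators Classical

noncomputable section

lemma aux_exp_int (n : ℕ) (R : ℝ) (hR : 0 < R) :
    ∫ x in Set.Ioi (0:ℝ), x ^ n * Real.exp (-(R * x)) = (n.factorial : ℝ) / R ^ (n + 1) := by
  have h := Real.integral_rpow_mul_exp_neg_mul_Ioi (a := (n:ℝ) + 1) (r := R) (by positivity) hR
  rw [Real.Gamma_nat_eq_factorial] at h
  have e : (n:ℝ) + 1 = ((n + 1 : ℕ) : ℝ) := by push_cast; ring
  have e2 : (n:ℝ) + 1 - 1 = (n : ℝ) := by ring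
  rw [e2] at h
  rw [e, Real.rpow_natCast] at h
  simp only [Real.rpow_natCast] at h
  rw [h, one_div, inv_pow]
  field_simp

lemma aux_exp_integrable (n : ℕ) (R : ℝ) (hR : 0 < R) :
    IntegrableOn (fun x : ℝ => x ^ n * Real.exp (-(R * x))) (Set.Ioi 0) := by
  have h := integrableOn_rpow_mul_exp_neg_mul_rpow (p := 1) (s := n) (b := R)
    (by have : (0:ℝ) ≤ n := by positivity
        linarith) one_pos hR
  simpa [Real.rpow_natCast] using h

lemma aux_pdf (x : ℝ) : gaussianPDFReal 0 1 x = (√(2 * π))⁻¹ * Real.exp (-(x^2/2)) := by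
  simp [gaussianPDFReal, neg_div]

lemma aux_J (n : ℕ) (r R : ℝ) (hr : 0 < r) (hR : r ≤ R) :
    (√(2 * π))⁻¹ * ((n.factorial : ℝ) / R ^ (n + 1) - ((n+2).factorial : ℝ) / R ^ (n + 3) / 2) ≤
    ∫ g, Real.exp (-(r * g)) * (if 0 < g then (1:ℝ) else 0) * g ^ n ∂(gaussianReal 0 1) := by
  have hR0 : 0 < R := lt_of_lt_of_le hr hR
  rw [integral_gaussianReal_eq_integral_smul one_ne_zero]
  have h1 : (fun x : ℝ => gaussianPDFReal 0 1 x • (Real.exp (-(r * x)) * (if 0 < x then (1:ℝ) else 0) * x ^ n))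
      = (Set.Ioi (0:ℝ)).indicator
        (fun x => (√(2 * π))⁻¹ * (Real.exp (-(x^2/2)) * (x ^ n * Real.exp (-(r * x))))) := by
    ext x
    simp only [Set.indicator, Set.mem_Ioi, aux_pdf, smul_eq_mul]
    split_ifs <;> ring
  rw [h1, integral_indicator measurableSet_Ioi, integral_const_mul]
  refine mul_le_mul_of_nonneg_left ?_ (by positivity)
  rw [← aux_exp_int n R hR0, ← aux_exp_int (n+2) R hR0, ← integral_div, ← integral_sub
    (aux_exp_integrable n R hR0) ((aux_exp_integrable (n+2) R hR0).div_const 2)]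
  refine setIntegral_mono_on ((aux_exp_integrable n R hR0).sub
    ((aux_exp_integrable (n+2) R hR0).div_const 2)) ?_ measurableSet_Ioi ?_
  · refine Integrable.bdd_mul (c := 1) (aux_exp_integrable n r hr) ?_ ?_
    · exact Continuous.aestronglyMeasurable (by fun_prop)
    · refine Filter.Eventually.of_forall fun x => ?_
      rw [Real.norm_eq_abs, Real.abs_exp]
      exact Real.exp_le_one_iff.2 (by nlinarith [sq_nonneg x])
  · intro x hx
    have hx : 0 < x := hx
    have e1 : x ^ n * Real.exp (-(R * x)) - x ^ (n+2) * Real.exp (-(R * x)) / 2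
      = (1 - x^2/2) * (x ^ n * Real.exp (-(R * x))) := by ring
    rw [e1]
    have e2 : 1 - x^2/2 ≤ Real.exp (-(x^2/2)) := by
      have := Real.add_one_le_exp (-(x^2/2)); linarith
    have e3 : Real.exp (-(R * x)) ≤ Real.exp (-(r * x)) :=
      Real.exp_le_exp.2 (by nlinarith)
    calc _ ≤ Real.exp (-(x^2/2)) * (x ^ n * Real.exp (-(R * x))) := by gcongr
      _ ≤ _ := by gcongr

lemma aux_abs1 : 1 / 2 ≤ ∫ h, |h| ∂(gaussianReal 0 1) := by
  rw [integral_gaussianReal_eq_integral_smul one_ne_zero]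
  have h1 : ∀ x : ℝ, gaussianPDFReal 0 1 x • |x| = (√(2 * π))⁻¹ * (|x| * Real.exp (-(1/2) * |x| ^ 2)) := by
    intro x
    rw [aux_pdf, sq_abs, smul_eq_mul]
    ring_nf
  simp only [h1]
  rw [integral_const_mul, integral_comp_abs (f := fun x => x * Real.exp (-(1/2) * x ^ 2))]
  have h2 := integral_rpow_mul_exp_neg_mul_rpow (p := 2) (q := 1) (b := 1/2) (by norm_num)
    (by norm_num) (by norm_num)
  have h3 : ∫ x in Set.Ioi (0:ℝ), x * Real.exp (-(1/2) * x ^ 2) = 1 := by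
    have : ((1:ℝ)/2) ^ (-(1 + 1) / 2 : ℝ) = 2 := by
      norm_num [Real.rpow_neg_one]
    rw [this] at h2
    norm_num at h2
    norm_num
    exact h2
  rw [h3]
  have h4 : √(2 * π) ≤ 4 := by
    rw [Real.sqrt_le_left (by norm_num)]
    linarith [Real.pi_le_four]
  have h5 : 0 < √(2 * π) := by positivity
  rw [mul_one, inv_mul_eq_div, div_le_div_iff₀ (by norm_num) h5]
  linarith

lemma aux_abs (σ : ℝ) (hσ : 0 ≤ σ) :
    σ / 2 ≤ ∫ h, |h| ∂(gaussianReal 0 (σ^2).toNNReal) := by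
  have h := gaussianReal_map_const_mul (μ := 0) (v := 1) σ
  have e : (gaussianReal 0 (σ^2).toNNReal) = (gaussianReal 0 1).map (σ * ·) := by
    rw [h]
    congr 1
    · simp
    · rw [mul_one]; exact Real.toNNReal_of_nonneg (sq_nonneg σ)
  rw [e, integral_map (by fun_prop) (by fun_prop)]
  simp only [abs_mul, abs_of_nonneg hσ]
  rw [integral_const_mul]
  nlinarith [aux_abs1]

lemma aux_law (d : ℕ) (e w : EuclideanSpace ℝ (Fin d)) (he : ‖e‖ = 1) (hw : ⟪e, w⟫ = 0) :
    (_root_.stdGaussian d).map (fun a => (⟪a, e⟫, ⟪a, w⟫)) =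
      (gaussianReal 0 1).prod (gaussianReal 0 (‖w‖^2).toNNReal) := by
  have h0 : _root_.stdGaussian d = ProbabilityTheory.stdGaussian (EuclideanSpace ℝ (Fin d)) := by
    rw [← map_pi_eq_stdGaussian]
    rfl
  rw [h0]
  set P := ProbabilityTheory.stdGaussian (EuclideanSpace ℝ (Fin d)) with hP
  have hc : ∀ u v : EuclideanSpace ℝ (Fin d), cov[fun a => ⟪a, u⟫, fun a => ⟪a, v⟫; P] = ⟪u, v⟫ := by
    intro u v
    have := covarianceBilin_apply_eq_cov (μ := P) (IsGaussian.memLp_two_id) u v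
    rw [hP, covarianceBilin_stdGaussian] at this
    have f : ∀ z : EuclideanSpace ℝ (Fin d), (fun a => ⟪a, z⟫) = (fun a => ⟪z, a⟫) := by
      intro z; ext a; exact real_inner_comm _ _
    rw [f u, f v, ← this]
    rfl
  have hlaw : HasGaussianLaw (fun a : EuclideanSpace ℝ (Fin d) => (⟪a, e⟫, ⟪a, w⟫)) P := by
    have := (IsGaussian.hasGaussianLaw_id (μ := P)).map_fun
      ((innerSL ℝ e).prod (innerSL ℝ w))
    simpa [real_inner_comm] using this
  have hind := hlaw.indepFun_of_covariance_eq_zero (by rw [hc, hw])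
  have hm : ∀ u : EuclideanSpace ℝ (Fin d), P.map (fun a => ⟪a, u⟫) = gaussianReal 0 (‖u‖^2).toNNReal := by
    intro u
    have h1 : HasGaussianLaw (fun a : EuclideanSpace ℝ (Fin d) => ⟪a, u⟫) P := by
      have := (IsGaussian.hasGaussianLaw_id (μ := P)).map_fun (innerSL ℝ u)
      simpa [real_inner_comm] using this
    rw [h1.map_eq_gaussianReal]
    congr 1
    · have := integral_strongDual_stdGaussian (innerSL ℝ u)
      simpa [real_inner_comm] using this
    · rw [← covariance_self (by fun_prop), hc, real_inner_self_eq_norm_sq]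
  rw [(indepFun_iff_map_prod_eq_prod_map_map (by fun_prop) (by fun_prop)).1 hind, hm, hm, he]
  simp

lemma aux_prod (r α σ : ℝ) (hr : 0 < r) (v : NNReal) :
    let I := ∫ p : ℝ × ℝ, Real.exp (-(r * p.1)) * |α * p.1 + p.2| *
      (if 0 < p.1 then (1:ℝ) else 0) ∂((gaussianReal 0 1).prod (gaussianReal 0 v))
    |α| * (∫ g, Real.exp (-(r * g)) * (if 0 < g then (1:ℝ) else 0) * g ^ 1 ∂(gaussianReal 0 1)) ≤ I ∧
    (∫ g, Real.exp (-(r * g)) * (if 0 < g then (1:ℝ) else 0) * g ^ 0 ∂(gaussianReal 0 1)) *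
      (∫ h, |h| ∂(gaussianReal 0 v)) ≤ I := by
  intro I
  set μ := (gaussianReal 0 1).prod (gaussianReal 0 v) with hμ
  set K : ℝ → ℝ := fun g => Real.exp (-(r * g)) * (if 0 < g then (1:ℝ) else 0) with hK
  have hKm : Measurable K := by
    refine Measurable.mul (by fun_prop) ?_
    exact Measurable.ite measurableSet_Ioi measurable_const measurable_const
  have hK0 : ∀ g, 0 ≤ K g := by
    intro g; simp only [hK]; split_ifs <;> positivity
  have hK1 : ∀ g, K g ≤ 1 := by
    intro g; simp only [hK]; split_ifs with h
    · rw [mul_one]; exact Real.exp_le_one_iff.2 (by nlinarith)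
    · simp
  have hi : ∀ v' : NNReal, Integrable (fun x : ℝ => x) (gaussianReal 0 v') := fun v' =>
    IsGaussian.integrable_id
  have i1 : Integrable (fun p : ℝ × ℝ => p.1) μ := (hi 1).comp_fst _
  have i2 : Integrable (fun p : ℝ × ℝ => p.2) μ := (hi v).comp_snd _
  have bd : ∀ f : ℝ × ℝ → ℝ, Integrable f μ → Integrable (fun p => K p.1 * f p) μ := by
    intro f hf
    refine Integrable.bdd_mul (c := 1) hf (hKm.comp measurable_fst).aestronglyMeasurable ?_
    refine Filter.Eventually.of_forall fun x => ?_
    rw [Real.norm_eq_abs, abs_of_nonneg (hK0 _)]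
    exact hK1 _
  have iF : Integrable (fun p : ℝ × ℝ => K p.1 * |α * p.1 + p.2|) μ :=
    bd _ ((i1.const_mul α).add i2).abs
  have iG : Integrable (fun p : ℝ × ℝ => K p.1 * |α * p.1 - p.2|) μ :=
    bd _ ((i1.const_mul α).sub i2).abs
  have hI : I = ∫ p, K p.1 * |α * p.1 + p.2| ∂μ := by
    simp only [I, hK]
    congr 1; ext p; ring
  have hI2 : I = ∫ p, K p.1 * |α * p.1 - p.2| ∂μ := by
    have hmap : μ.map (Prod.map id (fun y : ℝ => -y)) = μ := by
      rw [hμ, ← Measure.map_prod_map _ _ measurable_id measurable_neg, gaussianReal_map_neg]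
      simp
    rw [hI]
    conv_lhs => rw [← hmap]
    rw [integral_map (by fun_prop) (by fun_prop)]
    simp [sub_eq_add_neg]
  have hsum : I = ∫ p, K p.1 * ((|α * p.1 + p.2| + |α * p.1 - p.2|) / 2) ∂μ := by
    have : I = (I + I) / 2 := by ring
    rw [this]
    nth_rewrite 1 [hI]
    rw [hI2, ← integral_add iF iG, ← integral_div]
    congr 1; ext p; ring
  have iS : Integrable (fun p : ℝ × ℝ => K p.1 * ((|α * p.1 + p.2| + |α * p.1 - p.2|) / 2)) μ := by
    refine ((iF.add iG).div_const 2).congr (Filter.Eventually.of_forall fun p => ?_)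
    simp only [Pi.add_apply]; ring
  constructor
  · have e : |α| * (∫ g, K g * g ^ 1 ∂(gaussianReal 0 1)) = ∫ p, K p.1 * (|α| * p.1) ∂μ := by
      rw [← integral_const_mul, hμ, integral_fun_fst (f := fun g => K g * (|α| * g))]
      simp
      congr 1; ext p; ring
    rw [e, hsum]
    refine integral_mono (bd _ (i1.const_mul _)) iS fun p => ?_
    refine mul_le_mul_of_nonneg_left ?_ (hK0 _)
    have : |α| * p.1 ≤ |α * p.1| := by
      rw [abs_mul]; exact mul_le_mul_of_nonneg_left (le_abs_self _) (abs_nonneg _)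
    have h2 := abs_add_le (α * p.1 + p.2) (α * p.1 - p.2)
    have h3 : (α * p.1 + p.2) + (α * p.1 - p.2) = 2 * (α * p.1) := by ring
    rw [h3, abs_mul, abs_two] at h2
    linarith
  · have e : (∫ g, K g * g ^ 0 ∂(gaussianReal 0 1)) * (∫ h, |h| ∂(gaussianReal 0 v))
        = ∫ p, K p.1 * |p.2| ∂μ := by
      rw [hμ, integral_prod_mul (f := K) (g := fun y => |y|)]
      simp
    rw [e, hsum]
    refine integral_mono (bd _ i2.abs) iS fun p => ?_
    refine mul_le_mul_of_nonneg_left ?_ (hK0 _)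
    have h2 := abs_sub (α * p.1 + p.2) (α * p.1 - p.2)
    have h3 : (α * p.1 + p.2) - (α * p.1 - p.2) = 2 * p.2 := by ring
    rw [h3, abs_mul, abs_two] at h2
    linarith

set_option maxHeartbeats 1000000 in
/-- Aiming in expectation: for a single standard Gaussian vector `a` and any `x` with
`0 < ‖x‖ ≤ 3‖x⋆‖`,
`E[exp(-⟨a,x⟩)|⟨a,x-x⋆⟩| 𝟙{⟨a,x⟩>0}] ≥ ‖x-x⋆‖ / (√(8π)(1 + 9π‖x⋆‖²))`. -/
theorem aiming_in_expectation (d : ℕ) (hd : 1 ≤ d) (xstar : EuclideanSpace ℝ (Fin d))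
    (hxstar : 1 ≤ ‖xstar‖) (x : EuclideanSpace ℝ (Fin d))
    (hx0 : 0 < ‖x‖) (hx3 : ‖x‖ ≤ 3 * ‖xstar‖) :
    ‖x - xstar‖ / (Real.sqrt (8 * π) * (1 + 9 * π * ‖xstar‖ ^ 2)) ≤
      ∫ a, Real.exp (-⟪a, x⟫) * |⟪a, x - xstar⟫| *
          (if 0 < ⟪a, x⟫ then (1 : ℝ) else 0) ∂(stdGaussian d) := by
  set r := ‖x‖ with hr
  set R := 3 * ‖xstar‖ with hR
  have hR3 : 3 ≤ R := by linarith
  set v := x - xstar with hv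
  set e := r⁻¹ • x with he
  have he1 : ‖e‖ = 1 := by
    rw [he, norm_smul, norm_inv, Real.norm_eq_abs, abs_of_pos hx0, ← hr]
    field_simp
  have hxe : x = r • e := by rw [he, smul_smul, mul_inv_cancel₀ hx0.ne', one_smul]
  set α := ⟪e, v⟫ with hα
  set w := v - α • e with hw
  have hew : ⟪e, w⟫ = 0 := by
    rw [hw, inner_sub_right, inner_smul_right, real_inner_self_eq_norm_sq, he1]
    simp [hα]
  have hvw : v = α • e + w := by rw [hw]; abel
  have hn : ‖v‖ ≤ |α| + ‖w‖ := by
    calc ‖v‖ = ‖α • e + w‖ := by rw [← hvw]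
      _ ≤ ‖α • e‖ + ‖w‖ := norm_add_le _ _
      _ = _ := by rw [norm_smul, he1, Real.norm_eq_abs, mul_one]
  have hint : ∫ a, Real.exp (-⟪a, x⟫) * |⟪a, v⟫| *
          (if 0 < ⟪a, x⟫ then (1 : ℝ) else 0) ∂(_root_.stdGaussian d) =
      ∫ p : ℝ × ℝ, Real.exp (-(r * p.1)) * |α * p.1 + p.2| *
      (if 0 < p.1 then (1:ℝ) else 0) ∂((gaussianReal 0 1).prod (gaussianReal 0 (‖w‖^2).toNNReal)) := by
    rw [← aux_law d e w he1 hew, integral_map (by fun_prop)]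
    · congr 1; ext a
      have e1 : ⟪a, x⟫ = r * ⟪a, e⟫ := by
        conv_lhs => rw [hxe, inner_smul_right]
      have e2 : ⟪a, v⟫ = α * ⟪a, e⟫ + ⟪a, w⟫ := by
        conv_lhs => rw [hvw, inner_add_right, inner_smul_right]
      rw [e1, e2]
      simp only [mul_pos_iff_of_pos_left hx0]
    · refine Measurable.aestronglyMeasurable ?_
      refine Measurable.mul (by fun_prop) ?_
      exact Measurable.ite (measurableSet_lt measurable_const measurable_fst)
        measurable_const measurable_const
  rw [hint]
  obtain ⟨b1, b2⟩ := aux_prod r α 0 hx0 (‖w‖^2).toNNReal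
  have j0 := aux_J 0 r R hx0 hx3
  have j1 := aux_J 1 r R hx0 hx3
  have ha := aux_abs ‖w‖ (norm_nonneg _)
  have hs : √(8 * π) = 2 * √(2 * π) := by
    rw [show 8 * π = 2 ^ 2 * (2 * π) by ring, Real.sqrt_mul (by positivity),
      Real.sqrt_sq (by norm_num)]
  have hRR : 9 * π * ‖xstar‖ ^ 2 = π * R ^ 2 := by rw [hR]; ring
  rw [hs, hRR]
  have hS : 0 < √(2 * π) := by positivity
  set S := √(2 * π)
  have hpi := Real.pi_gt_three
  have hR0 : 0 < R := by linarith
  have hT : ‖v‖ / (2 * S * (1 + π * R ^ 2)) ≤ S⁻¹ * (‖v‖ / (6 * R ^ 2)) := by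
    rw [← div_eq_inv_mul, div_div]
    refine div_le_div_of_nonneg_left (norm_nonneg _) (by positivity) ?_
    nlinarith [mul_pos hS (pow_pos hR0 2), mul_nonneg hS.le (mul_nonneg (sub_nonneg.2 hpi.le) (sq_nonneg R))]
  refine hT.trans ?_
  rcases le_total (‖v‖ / 2) |α| with h | h
  · refine le_trans ?_ b1
    refine le_trans ?_ (mul_le_mul_of_nonneg_left j1 (abs_nonneg _))
    have q : 2 / (3 * R ^ 2) ≤
        (((1:ℕ).factorial : ℝ) / R ^ (1 + 1) - ((1+2:ℕ).factorial : ℝ) / R ^ (1 + 3) / 2) := by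
      have z : ((1:ℕ).factorial : ℝ) / R ^ (1 + 1) - ((1+2:ℕ).factorial : ℝ) / R ^ (1 + 3) / 2
          - 2 / (3 * R ^ 2) = (R ^ 2 - 9) / (3 * R ^ 4) := by
        norm_num [Nat.factorial]
        field_simp
        ring
      have : 0 ≤ (R ^ 2 - 9) / (3 * R ^ 4) := div_nonneg (by nlinarith) (by positivity)
      linarith
    calc S⁻¹ * (‖v‖ / (6 * R ^ 2)) ≤ S⁻¹ * ((‖v‖ / 2) * (2 / (3 * R ^ 2))) := by
          refine mul_le_mul_of_nonneg_left ?_ (by positivity)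
          rw [div_mul_div_comm, div_le_div_iff₀ (by positivity) (by positivity)]
          nlinarith [mul_nonneg (norm_nonneg v) (sq_nonneg R)]
      _ ≤ S⁻¹ * (|α| * (2 / (3 * R ^ 2))) := by gcongr
      _ = |α| * (S⁻¹ * (2 / (3 * R ^ 2))) := by ring
      _ ≤ _ := by gcongr
  · have h' : ‖v‖ / 2 ≤ ‖w‖ := by linarith
    refine le_trans ?_ b2
    have q : 2 / (3 * R) ≤
        (((0:ℕ).factorial : ℝ) / R ^ (0 + 1) - ((0+2:ℕ).factorial : ℝ) / R ^ (0 + 3) / 2) := by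
      have z : ((0:ℕ).factorial : ℝ) / R ^ (0 + 1) - ((0+2:ℕ).factorial : ℝ) / R ^ (0 + 3) / 2
          - 2 / (3 * R) = (R ^ 2 - 3) / (3 * R ^ 3) := by
        norm_num [Nat.factorial]
        field_simp
        ring
      have : 0 ≤ (R ^ 2 - 3) / (3 * R ^ 3) := div_nonneg (by nlinarith) (by positivity)
      linarith
    calc S⁻¹ * (‖v‖ / (6 * R ^ 2)) ≤ S⁻¹ * (2 / (3 * R)) * ((‖v‖ / 2) / 2) := by
          rw [mul_assoc]
          refine mul_le_mul_of_nonneg_left ?_ (by positivity)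
          have z : 2 / (3 * R) * (‖v‖ / 2 / 2) = ‖v‖ / (6 * R) := by
            field_simp
            ring
          rw [z]
          refine div_le_div_of_nonneg_left (norm_nonneg _) (by positivity) ?_
          nlinarith
      _ ≤ S⁻¹ * (2 / (3 * R)) * (‖w‖ / 2) := by gcongr
      _ ≤ _ := by
        refine mul_le_mul ((mul_le_mul_of_nonneg_left q (by positivity)).trans j0) ha (by positivity) ?_
        exact le_trans (by positivity) ((mul_le_mul_of_nonneg_left q (by positivity)).trans j0)
end
end
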